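/- arXiv:1611.08803 — 2 statements merged into one kernel-verified Lean document; each statement's English description precedes it below -/
import Mathlib

section
/- For intervals A1 = ⟨a1,b1⟩ and A2 = ⟨a2,b2⟩ of consecutive odd or even nonnegative integers, the set A1⊗A2 equals: ⟨0, b1+b2⟩ if A1 ∩ A2 ≠ ∅; ⟨1, b1+b2⟩ if a2 ≤ b1, a1 ≤ b2 and A1 ∩ A2 = ∅; ⟨a1−b2, b1+b2⟩ if b2 < a1; and ⟨a2−b1, b1+b2⟩ if b1 < a2. -/
open Classical

/-- `⟨a,b⟩`: the set `{a, a+2, …, b}` of consecutive odd or even integers. -/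
def Iv (a b : ℕ) : Set ℕ := {x | a ≤ x ∧ x ≤ b ∧ x % 2 = a % 2}

/-- `A ⊗ B = {a + b − 2i : a ∈ A, b ∈ B, 0 ≤ i ≤ min(a,b)}`. -/
def otimes (A B : Set ℕ) : Set ℕ :=
  {x | ∃ a ∈ A, ∃ b ∈ B, ∃ i, i ≤ min a b ∧ x = a + b - 2 * i}

theorem mem_otimes_iff {A B : Set ℕ} {x : ℕ} :
    x ∈ otimes A B ↔
      ∃ a ∈ A, ∃ b ∈ B, a ≤ b + x ∧ b ≤ a + x ∧ x ≤ a + b ∧ x % 2 = (a + b) % 2 := by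
  constructor
  · rintro ⟨a, ha, b, hb, i, hi, rfl⟩
    exact ⟨a, ha, b, hb, by omega⟩
  · rintro ⟨a, ha, b, hb, h⟩
    exact ⟨a, ha, b, hb, (a + b - x) / 2, by omega, by omega⟩

/-- Every `x ≤ b₁ + b₂` of the right parity that is at least the distance between some pair of
elements of the two intervals lies in their product. -/
theorem mem_otimes_Iv {a₁ b₁ a₂ b₂ p q x : ℕ} (hb₁ : b₁ % 2 = a₁ % 2) (hb₂ : b₂ % 2 = a₂ % 2)
    (hp : p ∈ Iv a₁ b₁) (hq : q ∈ Iv a₂ b₂) (hpx : p ≤ q + x) (hqx : q ≤ p + x)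
    (hx : x ≤ b₁ + b₂) (hpar : x % 2 = (a₁ + a₂) % 2) :
    x ∈ otimes (Iv a₁ b₁) (Iv a₂ b₂) := by
  rw [mem_otimes_iff]
  simp only [Iv, Set.mem_ofPred_eq] at *
  by_cases h : x ≤ p + q
  · exact ⟨p, hp, q, hq, by omega⟩
  by_cases h' : x ≤ b₁ + q
  · exact ⟨x - q, by omega, q, hq, by omega⟩
  · exact ⟨b₁, by omega, x - b₁, by omega, by omega⟩

/-- A description of the product of two intervals as an interval, given a pair `p`, `q` of
elements at minimal distance `d`. -/
theorem otimes_Iv_eq_of_dist {a₁ b₁ a₂ b₂ p q d : ℕ} (hb₁ : b₁ % 2 = a₁ % 2)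
    (hb₂ : b₂ % 2 = a₂ % 2) (hp : p ∈ Iv a₁ b₁) (hq : q ∈ Iv a₂ b₂)
    (hpq : p = q + d ∨ q = p + d)
    (hd : ∀ a ∈ Iv a₁ b₁, ∀ b ∈ Iv a₂ b₂, a + d ≤ b ∨ b + d ≤ a) :
    otimes (Iv a₁ b₁) (Iv a₂ b₂) = Iv d (b₁ + b₂) := by
  ext x
  constructor
  · rw [mem_otimes_iff]
    rintro ⟨a, ha, b, hb, h⟩
    have := hd a ha b hb
    simp only [Iv, Set.mem_ofPred_eq] at *
    omega
  · intro hx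
    have hp' := hp
    have hq' := hq
    simp only [Iv, Set.mem_ofPred_eq] at hx hp' hq'
    exact mem_otimes_Iv hb₁ hb₂ hp hq (by omega) (by omega) (by omega) (by omega)

/-- for intervals `A₁ = ⟨a₁,b₁⟩` and `A₂ = ⟨a₂,b₂⟩` of consecutive odd or
even nonnegative integers, `A₁ ⊗ A₂` equals `⟨0, b₁+b₂⟩` if `A₁ ∩ A₂ ≠ ∅`;
`⟨1, b₁+b₂⟩` if `a₂ ≤ b₁`, `a₁ ≤ b₂` and `A₁ ∩ A₂ = ∅`; `⟨a₁−b₂, b₁+b₂⟩` if `b₂ < a₁`;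
and `⟨a₂−b₁, b₁+b₂⟩` if `b₁ < a₂`. -/
theorem otimes_Iv_eq (a₁ k₁ a₂ k₂ b₁ b₂ : ℕ)
    (hb₁ : b₁ = a₁ + 2 * k₁) (hb₂ : b₂ = a₂ + 2 * k₂) :
    ((Iv a₁ b₁ ∩ Iv a₂ b₂).Nonempty →
      otimes (Iv a₁ b₁) (Iv a₂ b₂) = Iv 0 (b₁ + b₂)) ∧
    (a₂ ≤ b₁ → a₁ ≤ b₂ → Iv a₁ b₁ ∩ Iv a₂ b₂ = ∅ →
      otimes (Iv a₁ b₁) (Iv a₂ b₂) = Iv 1 (b₁ + b₂)) ∧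
    (b₂ < a₁ → otimes (Iv a₁ b₁) (Iv a₂ b₂) = Iv (a₁ - b₂) (b₁ + b₂)) ∧
    (b₁ < a₂ → otimes (Iv a₁ b₁) (Iv a₂ b₂) = Iv (a₂ - b₁) (b₁ + b₂)) := by
  have h₁ : b₁ % 2 = a₁ % 2 := by omega
  have h₂ : b₂ % 2 = a₂ % 2 := by omega
  refine ⟨?_, fun h h' hempty => ?_, fun h => ?_, fun h => ?_⟩
  · rintro ⟨c, hc₁, hc₂⟩
    exact otimes_Iv_eq_of_dist h₁ h₂ hc₁ hc₂ (by omega) fun a _ b _ => by omega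
  · have hpar : a₁ % 2 ≠ a₂ % 2 := fun hpar => by
      have hmem : max a₁ a₂ ∈ Iv a₁ b₁ ∩ Iv a₂ b₂ := by
        simp only [Iv, Set.mem_inter_iff, Set.mem_ofPred_eq]
        omega
      simp [hempty] at hmem
    have hd : ∀ a ∈ Iv a₁ b₁, ∀ b ∈ Iv a₂ b₂, a + 1 ≤ b ∨ b + 1 ≤ a := by
      simp only [Iv, Set.mem_ofPred_eq]
      intros
      omega
    rcases le_total a₁ a₂ with hle | hle
    · exact otimes_Iv_eq_of_dist (p := a₂ - 1) (q := a₂) h₁ h₂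
        (by simp only [Iv, Set.mem_ofPred_eq]; omega)
        (by simp only [Iv, Set.mem_ofPred_eq, and_true]; omega) (by omega) hd
    · exact otimes_Iv_eq_of_dist (p := a₁) (q := a₁ - 1) h₁ h₂
        (by simp only [Iv, Set.mem_ofPred_eq, and_true]; omega)
        (by simp only [Iv, Set.mem_ofPred_eq]; omega) (by omega) hd
  · refine otimes_Iv_eq_of_dist (p := a₁) (q := b₂) h₁ h₂ ?_ ?_ (by omega) ?_ <;>
      simp only [Iv, Set.mem_ofPred_eq, and_true] <;> intros <;> omega
  · refine otimes_Iv_eq_of_dist (p := b₁) (q := a₂) h₁ h₂ ?_ ?_ (by omega) ?_ <;>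
      simp only [Iv, Set.mem_ofPred_eq, and_true] <;> intros <;> omega
end

section
/- (Main Lemma (i)) Let e=(u,v) be a non-leaf-edge of depth d−1 in a rooted tree instance, assume all edges of depth at least d satisfy conditions (a) and (b), and let ⟨ã,b̃⟩ = Ψ(e1)⊗Ψ(e2) for the two child-edges e1, e2 of e. If f is a blocking flow of I(e) with e ∈ E(V_f(t)) for some terminal t ∈ T_e, then the path P_{v,t} is a dominating path, every decomposition g of every blocking flow of I(e) satisfies g(u,t) ≥ c(e), and c(e) < ã. -/
open Classical

/-- A tree instance `(G,T,c)` rooted at a terminal `r`: a tree on vertex set `V`,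
encoded by the parent function `par` (with `par root = root`) together with a depth
function certifying acyclicity.  Each non-root vertex `v` is identified with the edge
`(par v, v)`; `c v` is the (positive integer) capacity of that edge.  The terminals are
the leaves; the root has exactly one child and every internal vertex has exactly
two children (total degree 3). -/
structure RTI (V : Type*) where
  root : V
  par : V → V
  dep : V → ℕ
  c : V → ℕ
  par_root : par root = root
  dep_root : dep root = 0
  dep_par : ∀ v, v ≠ root → dep v = dep (par v) + 1
  cap_pos : ∀ v, v ≠ root → 1 ≤ c v
  root_degree : {w : V | par w = root ∧ w ≠ root}.ncard = 1
  internal_degree : ∀ v, v ≠ root → {w : V | par w = v ∧ w ≠ root}.Nonempty →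
    {w : V | par w = v ∧ w ≠ root}.ncard = 2

namespace RTI

variable {V : Type*} (R : RTI V)

/-- `R.below u v`: `v` lies in the subtree rooted at `u` (i.e. `u` is an ancestor of
`v`, allowing `u = v`). -/
def below (u v : V) : Prop :=
  Relation.ReflTransGen (fun a b => R.par b = a ∧ b ≠ R.root) u v

/-- `v` is a leaf of the tree other than the root. -/
def leaf (v : V) : Prop := v ≠ R.root ∧ ∀ w, w ≠ R.root → R.par w ≠ v

/-- The children of `v` (as lower endpoints of child-edges). -/
def children (v : V) : Set V := {w | R.par w = v ∧ w ≠ R.root}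

/-- For an edge `e = (par v, v)`, the vertex set `V_e` of the instance `I(e)`. -/
def Ve (v : V) : Set V := insert (R.par v) {w | R.below v w}

/-- `T_e`: the terminals of `I(e)` other than `u = par v`. -/
def Te (v : V) : Set V := {w | R.below v w ∧ R.leaf w}

/-- The full terminal set `T_e ∪ {u}` of the instance `I(e)`. -/
def S (v : V) : Set V := insert (R.par v) (R.Te v)

/-- The edge `(par x, x)` lies on the tree path between `t` and `t'`
(exactly one of `t, t'` is in the subtree below `x`). -/
def onPath (x t t' : V) : Prop :=
  (R.below x t ∧ ¬ R.below x t') ∨ (¬ R.below x t ∧ R.below x t')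

/-- The vertex `x` lies on the tree path between `t` and `t'`. -/
def onPathV (x t t' : V) : Prop :=
  (R.below x t ∨ R.below x t') ∧ ∀ z, R.below z t → R.below z t' → R.below z x

/-- Unordered pairs of distinct terminals of the instance `I(e)` for `e = (par v, v)`. -/
def PathPairs (v : V) : Set (Sym2 V) :=
  {p | ∃ t t', t ∈ R.S v ∧ t' ∈ R.S v ∧ t ≠ t' ∧ p = s(t, t')}

/-- `g` is a decomposition of `f` in the instance `I(e)`, `e = (par v, v)`:
`g` is supported on pairs of distinct terminals and, on every edge of `I(e)`,
`f` is the sum of `g` over the (unique) terminal-pair paths through that edge. -/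
def IsDecomp (v : V) (f : V → ℕ) (g : Sym2 V → ℕ) : Prop :=
  (∀ p, g p ≠ 0 → p ∈ R.PathPairs v) ∧
  ∀ w, R.below v w →
    f w = ∑ᶠ p ∈ {p : Sym2 V | ∃ t t', p = s(t, t') ∧ R.onPath w t t'}, g p

/-- `f` is an (integral) flow in the instance `I(e)`, `e = (par v, v)`. -/
def IsFlow (v : V) (f : V → ℕ) : Prop := ∃ g, R.IsDecomp v f g

/-- `f` is feasible in `I(e)`. -/
def Feasible (v : V) (f : V → ℕ) : Prop := ∀ w, R.below v w → f w ≤ R.c w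

/-- `V_f(s)`: the set of vertices `w` of `I(e)` reachable from `s` by travelling
upward along edges with `c − f ≥ 1` to a common ancestor and then downward along
edges with `c − f ≥ 2`. -/
def Vf (v : V) (f : V → ℕ) (s : V) : Set V :=
  {w | w ∈ R.Ve v ∧ ∃ z ∈ R.Ve v, R.below z s ∧ R.below z w ∧
    (∀ x, R.below z x → R.below x s → x ≠ z → f x + 1 ≤ R.c x) ∧
    (∀ x, R.below z x → R.below x w → x ≠ z → f x + 2 ≤ R.c x)}

/-- `W` induces a connected subgraph of the tree (it is closed under tree paths). -/
def ConnSet (W : Set V) : Prop :=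
  ∀ w₁ ∈ W, ∀ w₂ ∈ W, ∀ x, R.onPathV x w₁ w₂ → x ∈ W

/-- `E(X)` inside the instance `I(e)`, `e = (par v, v)`: the edges `(par x, x)` of
`I(e)` with exactly one endpoint in `X`. -/
def cutE (v : V) (X : Set V) : Set V :=
  {x | R.below v x ∧ ¬ (x ∈ X ↔ R.par x ∈ X)}

/-- `h(X) = Σ_{e' ∈ E(X)} h(e')` inside the instance `I(e)`, `e = (par v, v)`. -/
noncomputable def hval (v : V) (X : Set V) (h : V → ℕ) : ℕ := ∑ᶠ x ∈ R.cutE v X, h x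

/-- `W` is a connected component of the subgraph of `I(e)` induced by `A`. -/
def IsComp (v : V) (A W : Set V) : Prop :=
  W.Nonempty ∧ W ⊆ A ∧ R.ConnSet W ∧
  (∀ x, R.below v x → x ∈ W → R.par x ∈ A → R.par x ∈ W) ∧
  (∀ x, R.below v x → R.par x ∈ W → x ∈ A → x ∈ W)

/-- `odd(X)` (relative to the union `U` of the removed terminal sets): the components
`W` of `G_e − U` with `c(W)` odd whose parent-edge is a child-edge of `X`. -/
def oddOf (v : V) (U X : Set V) : Set (Set V) :=
  {W | R.IsComp v (R.Ve v \ U) W ∧ Odd (R.hval v W R.c) ∧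
    ∃ y ∈ W, R.par y ∉ W ∧ R.par y ∈ X}

/-- The union of the sets `V_f(t)`, `t ∈ T_e`. -/
def UT (v : V) (f : V → ℕ) : Set V := ⋃ t ∈ R.Te v, R.Vf v f t

/-- The union of the sets `V_f(t)`, `t ∈ T_e ∪ {u}`. -/
def USall (v : V) (f : V → ℕ) : Set V := ⋃ t ∈ R.S v, R.Vf v f t

/-- `f` is a blocking flow in `I(e)`, `e = (par v, v)`: a feasible flow such that
`{V_f(t) : t ∈ T_e}` is a cut-system of `T_e` (pairwise disjoint `t`-sets avoiding the
terminal `u = par v`) each member of which is blocked by `f`, i.e.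
`f(e_t) = f(V_f(t)) = c(V_f(t)) − |odd(V_f(t))|`. -/
def IsBlocking (v : V) (f : V → ℕ) : Prop :=
  R.IsFlow v f ∧ R.Feasible v f ∧
  (∀ t ∈ R.Te v, R.par v ∉ R.Vf v f t) ∧
  (∀ t ∈ R.Te v, ∀ t' ∈ R.Te v, t ≠ t' → R.Vf v f t ∩ R.Vf v f t' = ∅) ∧
  (∀ t ∈ R.Te v, f t = R.hval v (R.Vf v f t) f ∧
    R.hval v (R.Vf v f t) f + (R.oddOf v (R.UT v f) (R.Vf v f t)).ncard
      = R.hval v (R.Vf v f t) R.c)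

/-- `Ψ(e)`: the set of values `f(e)` of blocking flows `f` of `I(e)`, `e = (par v, v)`. -/
def Psi (v : V) : Set ℕ := {x | ∃ f, R.IsBlocking v f ∧ f v = x}

/-- `a(e)`: the least element of `Ψ(e)`. -/
noncomputable def aE (v : V) : ℕ := sInf (R.Psi v)

/-- `b(e)`: the greatest element of `Ψ(e)`. -/
noncomputable def bE (v : V) : ℕ := sSup (R.Psi v)

/-- The edge `(par x, x)` is dominating: `b(e') + 2 ≤ a(e)` for its sibling edge `e'`. -/
def Dominating (x : V) : Prop :=
  x ≠ R.root ∧ ∃ y, y ≠ R.root ∧ y ≠ x ∧ R.par y = R.par x ∧ R.bE y + 2 ≤ R.aE x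

/-- The path from `v` down to `t` consists of dominating edges. -/
def DomPath (v t : V) : Prop :=
  R.below v t ∧ ∀ x, R.below v x → R.below x t → x ≠ v → R.Dominating x

/-- Condition (a) for the edge `e = (par v, v)`. -/
def CondA (v : V) : Prop :=
  (∃ a b, R.Psi v = Iv a b) ∧
  (R.leaf v → R.Psi v = {R.c v}) ∧
  (∀ w₁ w₂, w₁ ≠ w₂ → R.children v = {w₁, w₂} →
    R.Psi v = (otimes (R.Psi w₁) (R.Psi w₂) ∩ Set.Iic (R.c v)) ∪ {R.c v})

/-- Condition (b) for the edge `e = (u,v)`: if `e` has a dominating child-edge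
`e' = (v,w)`, then there is a terminal `t ∈ T_{e'}` with `g(u,t) ≥ a(e)` for every
decomposition `g` of every blocking flow of `I(e)`, and `P_{v,t}` a dominating path. -/
def CondB (v : V) : Prop :=
  ∀ w ∈ R.children v, R.Dominating w →
    ∃ t ∈ R.Te w, R.DomPath v t ∧
      ∀ f g, R.IsBlocking v f → R.IsDecomp v f g → R.aE v ≤ g s(R.par v, t)

/-- `γ(𝒳)` for the cut-system `𝒳 = {V_f(t) : t ∈ T_e ∪ {u}}`. -/
noncomputable def gammaX (v : V) (f : V → ℕ) : ℕ :=
  ∑ᶠ t ∈ R.S v, R.hval v (R.Vf v f t) R.c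

/-- `κ(𝒳)` for the cut-system `𝒳 = {V_f(t) : t ∈ T_e ∪ {u}}`: the number of
components of `G_e − ∪𝒳` of odd capacity. -/
noncomputable def kappaX (v : V) (f : V → ℕ) : ℕ :=
  {W : Set V | R.IsComp v (R.Ve v \ R.USall v f) W ∧ Odd (R.hval v W R.c)}.ncard

end RTI

namespace RTI

variable {V : Type*} {R : RTI V}

theorem below.refl (a : V) : R.below a a := Relation.ReflTransGen.refl

theorem below.trans {a b c : V} (h : R.below a b) (h' : R.below b c) : R.below a c :=
  Relation.ReflTransGen.trans h h'

theorem below_par {w : V} (h : w ≠ R.root) : R.below (R.par w) w :=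
  Relation.ReflTransGen.single ⟨rfl, h⟩

theorem below.eq_or {a b : V} (h : R.below a b) :
    a = b ∨ (b ≠ R.root ∧ R.below a (R.par b)) := by
  rcases Relation.ReflTransGen.cases_tail h with h | ⟨c, hc, hcb, hb⟩
  · exact Or.inl h.symm
  · subst hcb
    exact Or.inr ⟨hb, hc⟩

theorem below.dep_le {a b : V} (h : R.below a b) : R.dep a ≤ R.dep b := by
  induction h with
  | refl => exact le_rfl
  | tail _ hbc ih =>
    have := R.dep_par _ hbc.2
    rw [hbc.1] at this
    omega

theorem below.eq_of_dep_le {a b : V} (h : R.below a b) (hd : R.dep b ≤ R.dep a) : a = b := by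
  rcases h.eq_or with h | ⟨hb, h⟩
  · exact h
  · have := h.dep_le
    have := R.dep_par _ hb
    omega

theorem below.antisymm {a b : V} (h : R.below a b) (h' : R.below b a) : a = b :=
  h.eq_of_dep_le h'.dep_le

theorem below.ne_root {a b : V} (h : R.below a b) (ha : a ≠ R.root) : b ≠ R.root := by
  rcases h.eq_or with h | h
  · exact h ▸ ha
  · exact h.1

theorem below.total {a b t : V} (h : R.below a t) (h' : R.below b t) :
    R.below a b ∨ R.below b a := by
  induction h with
  | refl => exact Or.inr h'
  | tail h₁ hbc ih =>
    rcases h'.eq_or with rfl | ⟨_, h⟩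
    · exact Or.inl (h₁.tail hbc)
    · rw [hbc.1] at h
      exact ih h

theorem not_below_par {w : V} (h : w ≠ R.root) : ¬ R.below w (R.par w) := fun h' => by
  have := h'.dep_le
  have := R.dep_par _ h
  omega

/-- Every vertex strictly below `a` lies below a child of `a`. -/
theorem below.exists_child {a b : V} (h : R.below a b) (hab : a ≠ b) :
    ∃ w ∈ R.children a, R.below w b := by
  rcases Relation.ReflTransGen.cases_head h with h | ⟨w, hw, hwb⟩
  · exact absurd h hab
  · exact ⟨w, hw, hwb⟩

theorem not_below_sibling {a b q : V} (hb : b ∈ R.children a) (hq : q ∈ R.children a)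
    (h : b ≠ q) : ¬ R.below b q := by
  intro hbq
  have h1 := R.dep_par _ hb.2
  have h2 := R.dep_par _ hq.2
  rw [hb.1] at h1
  rw [hq.1] at h2
  exact h (hbq.eq_of_dep_le (by omega))

theorem not_below_of_sibling {a b q s : V} (hb : b ∈ R.children a) (hq : q ∈ R.children a)
    (h : b ≠ q) (hs : R.below b s) : ¬ R.below q s := fun hs' =>
  (hs.total hs').elim (not_below_sibling hb hq h) (not_below_sibling hq hb h.symm)

/-- A non-root vertex with a child `b` has exactly one further child. -/
theorem exists_sibling {a b : V} (ha : a ≠ R.root) (hb : b ∈ R.children a) :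
    ∃ q, b ≠ q ∧ R.children a = {b, q} := by
  obtain ⟨x, y, hxy, h⟩ := Set.ncard_eq_two.1 (R.internal_degree a ha ⟨b, hb⟩)
  change R.children a = {x, y} at h
  rw [h] at hb ⊢
  rcases hb with rfl | rfl
  · exact ⟨y, hxy, rfl⟩
  · exact ⟨x, hxy.symm, Set.pair_comm _ _⟩

theorem exists_child_of_not_leaf {a : V} (ha : a ≠ R.root) (h : ¬ R.leaf a) :
    ∃ b, b ∈ R.children a := by
  by_contra hc
  push Not at hc
  exact h ⟨ha, fun w hw hwa => hc w ⟨hwa, hw⟩⟩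

theorem leaf.eq_of_below {a b : V} (h : R.leaf a) (hab : R.below a b) : a = b := by
  by_contra hne
  obtain ⟨w, hw, -⟩ := hab.exists_child hne
  exact h.2 w hw.2 hw.1

theorem mem_Te_mono {v y s : V} (h : R.below v y) (hs : s ∈ R.Te y) : s ∈ R.Te v :=
  ⟨h.trans hs.1, hs.2⟩

/-- The terminal pair `p` is separated by the edge `(par x, x)`. -/
def Crosses (R : RTI V) (x : V) (p : Sym2 V) : Prop :=
  ∃ t t', p = s(t, t') ∧ R.onPath x t t'

theorem crosses_mk {x a b : V} : R.Crosses x s(a, b) ↔ R.onPath x a b := by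
  constructor
  · rintro ⟨t, t', h, h'⟩
    rcases Sym2.eq_iff.1 h with ⟨rfl, rfl⟩ | ⟨rfl, rfl⟩
    · exact h'
    · unfold onPath at *
      tauto
  · exact fun h => ⟨a, b, rfl, h⟩

theorem IsDecomp.apply_eq_sum {v : V} {f : V → ℕ} {g : Sym2 V → ℕ} [Fintype (Sym2 V)]
    (h : R.IsDecomp v f g) {w : V} (hw : R.below v w) :
    f w = ∑ p, if R.Crosses w p then g p else 0 := by
  rw [h.2 w hw, finsum_mem_def, finsum_eq_sum_of_fintype]
  refine Finset.sum_congr rfl fun p _ => ?_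
  rw [Set.indicator_apply]
  exact if_congr Iff.rfl rfl rfl

theorem IsDecomp.le_add [Finite V] {v : V} {f : V → ℕ} {g : Sym2 V → ℕ}
    (h : R.IsDecomp v f g) {x y z : V} (hx : R.below v x) (hy : R.below v y)
    (hz : R.below v z)
    (H : ∀ p, g p ≠ 0 → R.Crosses x p → R.Crosses y p ∨ R.Crosses z p) :
    f x ≤ f y + f z := by
  have : Fintype (Sym2 V) := Fintype.ofFinite _
  rw [h.apply_eq_sum hx, h.apply_eq_sum hy, h.apply_eq_sum hz, ← Finset.sum_add_distrib]
  refine Finset.sum_le_sum fun p _ => ?_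
  by_cases hp : g p = 0
  · simp [hp]
  · have := H p hp
    split_ifs <;> first | omega | tauto

theorem IsDecomp.eq_add [Finite V] {v : V} {f : V → ℕ} {g : Sym2 V → ℕ}
    (h : R.IsDecomp v f g) {x y z : V} (hx : R.below v x) (hy : R.below v y)
    (hz : R.below v z)
    (H : ∀ p, g p ≠ 0 → (R.Crosses x p ↔ (R.Crosses y p ∨ R.Crosses z p)) ∧
      ¬ (R.Crosses y p ∧ R.Crosses z p)) :
    f x = f y + f z := by
  have : Fintype (Sym2 V) := Fintype.ofFinite _
  rw [h.apply_eq_sum hx, h.apply_eq_sum hy, h.apply_eq_sum hz, ← Finset.sum_add_distrib]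
  refine Finset.sum_congr rfl fun p _ => ?_
  by_cases hp : g p = 0
  · simp [hp]
  · have := H p hp
    split_ifs <;> first | omega | tauto

/-- Below a vertex `a` with children `b`, `q`, a terminal of `I(v)` lies below `a` exactly if
it lies below `b` or below `q`. -/
theorem below_iff_of_children {v a b q s : V} (hv : v ≠ R.root) (hva : R.below v a)
    (hch : R.children a = {b, q}) (hs : s ∈ R.S v) :
    R.below a s ↔ R.below b s ∨ R.below q s := by
  have hb : b ∈ R.children a := hch ▸ Or.inl rfl
  have hq : q ∈ R.children a := hch ▸ Or.inr rfl
  constructor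
  · intro h
    have hne : a ≠ s := by
      rintro rfl
      rcases hs with hs | hs
      · subst hs
        exact not_below_par hv hva
      · exact hs.2.2 b hb.2 hb.1
    obtain ⟨w, hw, hws⟩ := h.exists_child hne
    rw [hch] at hw
    rcases hw with rfl | rfl
    · exact Or.inl hws
    · exact Or.inr hws
  · have h1 := below_par hb.2
    have h2 := below_par hq.2
    rw [hb.1] at h1
    rw [hq.1] at h2
    exact fun h => h.elim h1.trans h2.trans

theorem below_child {a b : V} (hb : b ∈ R.children a) : R.below a b := hb.1 ▸ below_par hb.2

theorem IsDecomp.mem_S {v : V} {f : V → ℕ} {g : Sym2 V → ℕ} (h : R.IsDecomp v f g) {a b : V}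
    (hp : g s(a, b) ≠ 0) : a ∈ R.S v ∧ b ∈ R.S v ∧ a ≠ b := by
  obtain ⟨t, t', ht, ht', hne, h⟩ := h.1 _ hp
  rcases Sym2.eq_iff.1 h with ⟨rfl, rfl⟩ | ⟨rfl, rfl⟩
  · exact ⟨ht, ht', hne⟩
  · exact ⟨ht', ht, hne.symm⟩

theorem IsDecomp.parent_le [Finite V] {v a b q : V} {f : V → ℕ} {g : Sym2 V → ℕ}
    (hv : v ≠ R.root) (h : R.IsDecomp v f g) (hva : R.below v a)
    (hch : R.children a = {b, q}) : f a ≤ f b + f q := by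
  have hb : b ∈ R.children a := hch ▸ Or.inl rfl
  have hq : q ∈ R.children a := hch ▸ Or.inr rfl
  refine h.le_add hva (hva.trans (below_child hb)) (hva.trans (below_child hq)) fun p => ?_
  induction p using Sym2.ind with | _ s s' =>
  intro hp
  obtain ⟨hs, hs', -⟩ := h.mem_S hp
  have h1 := below_iff_of_children hv hva hch hs
  have h2 := below_iff_of_children hv hva hch hs'
  simp only [crosses_mk, onPath]
  tauto

theorem IsDecomp.child_le [Finite V] {v a b q : V} {f : V → ℕ} {g : Sym2 V → ℕ}
    (hv : v ≠ R.root) (h : R.IsDecomp v f g) (hva : R.below v a) (hbq : b ≠ q)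
    (hch : R.children a = {b, q}) : f b ≤ f a + f q := by
  have hb : b ∈ R.children a := hch ▸ Or.inl rfl
  have hq : q ∈ R.children a := hch ▸ Or.inr rfl
  refine h.le_add (hva.trans (below_child hb)) hva (hva.trans (below_child hq)) fun p => ?_
  induction p using Sym2.ind with | _ s s' =>
  intro hp
  obtain ⟨hs, hs', -⟩ := h.mem_S hp
  have h1 := below_iff_of_children hv hva hch hs
  have h2 := below_iff_of_children hv hva hch hs'
  have h3 := fun h => not_below_of_sibling hb hq hbq (s := s) h
  have h4 := fun h => not_below_of_sibling hb hq hbq (s := s') h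
  simp only [crosses_mk, onPath]
  tauto

/-- If no edge of the downward path from `z` to `t` is cut by `X`, then `z` and `t` lie on the
same side of `X`. -/
theorem mem_iff_of_not_cut {X : Set V} {z t : V} (h : R.below z t)
    (H : ∀ x, R.below z x → R.below x t → x ≠ z → (x ∈ X ↔ R.par x ∈ X)) :
    z ∈ X ↔ t ∈ X := by
  induction h with
  | refl => rfl
  | tail hzb hbc ih =>
    rename_i b c
    have hb : R.below b c := Relation.ReflTransGen.single hbc
    have hne : c ≠ z := by
      rintro rfl
      exact not_below_par hbc.2 (hbc.1 ▸ hzb)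
    rw [ih fun x h1 h2 h3 => H x h1 (h2.trans hb) h3,
      H c (hzb.trans hb) (below.refl c) hne, hbc.1]

theorem exists_lca {v t s : V} (ht : R.below v t) (hs : R.below v s) :
    ∃ z, R.below v z ∧ R.below z t ∧ R.below z s ∧
      ∀ x, R.below z x → R.below x t → x ≠ z → ¬ R.below x s := by
  induction ht with
  | refl => exact ⟨v, below.refl v, below.refl v, hs, fun x h1 h2 h3 => absurd (h2.antisymm h1) h3⟩
  | tail hvb hbc ih =>
    rename_i b c
    have hb : R.below b c := Relation.ReflTransGen.single hbc
    obtain ⟨z, h1, h2, h3, h4⟩ := ih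
    by_cases hc : R.below c s
    · exact ⟨c, hvb.trans hb, below.refl c, hc, fun x h1 h2 h3 => absurd (h2.antisymm h1) h3⟩
    · refine ⟨z, h1, h2.trans hb, h3, fun x h5 h6 h7 => ?_⟩
      rcases h6.eq_or with rfl | ⟨_, h6⟩
      · exact hc
      · exact h4 x h5 (hbc.1 ▸ h6) h7

/-- A path between terminals of `I(v)` that `X` separates uses an edge of the cut of `X`. -/
theorem exists_cut_onPath {v : V} {X : Set V} {s s' : V}
    (hs : R.below (R.par v) s) (hs' : R.below (R.par v) s') (hX : s ∈ X) (hX' : s' ∉ X)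
    (hb : ∀ x, R.below (R.par v) x → x ≠ R.par v → (R.below x s ∨ R.below x s') →
      R.below v x) :
    ∃ x ∈ R.cutE v X, R.onPath x s s' := by
  by_contra hc
  push Not at hc
  obtain ⟨z, h1, h2, h3, h4⟩ := exists_lca hs hs'
  have key : ∀ x, R.below z x → x ≠ z → R.onPath x s s' → (x ∈ X ↔ R.par x ∈ X) := by
    intro x hzx hne hx
    by_contra hcut
    refine hc x ⟨hb x (h1.trans hzx) ?_ ?_, hcut⟩ hx
    · rintro rfl
      exact hne (h1.antisymm hzx)
    · exact hx.imp And.left And.right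
  have e1 := mem_iff_of_not_cut (X := X) h2 fun x hzx hxs hne =>
    key x hzx hne (Or.inl ⟨hxs, h4 x hzx hxs hne⟩)
  have e2 := mem_iff_of_not_cut (X := X) h3 fun x hzx hxs' hne =>
    key x hzx hne (Or.inr ⟨fun h => h4 x hzx h hne hxs', hxs'⟩)
  exact hX' (e2.1 (e1.2 hX))

theorem par_below_of_mem_S {v s : V} (hv : v ≠ R.root) (hs : s ∈ R.S v) :
    R.below (R.par v) s := by
  rcases hs with rfl | hs
  · exact below.refl _
  · exact (below_par hv).trans hs.1

theorem below_of_par_below {v x s : V} (hs : s ∈ R.S v) (hx : R.below (R.par v) x)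
    (hne : x ≠ R.par v) (hxs : R.below x s) : R.below v x := by
  rcases hs with rfl | hs
  · exact absurd (hxs.antisymm hx) hne
  · rcases hs.1.total hxs with h | h
    · exact h
    · rcases h.eq_or with rfl | ⟨_, h⟩
      · exact below.refl _
      · exact absurd (h.antisymm hx) hne

theorem mem_Vf_self {v s : V} {f : V → ℕ} (hs : s ∈ R.Ve v) : s ∈ R.Vf v f s :=
  ⟨hs, s, hs, below.refl s, below.refl s, fun _ h1 h2 h3 => absurd (h2.antisymm h1) h3,
    fun _ h1 h2 h3 => absurd (h2.antisymm h1) h3⟩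

theorem mem_Vf_of_up {v a s : V} {f : V → ℕ} (ha : a ∈ R.Ve v) (has : R.below a s)
    (H : ∀ x, R.below a x → R.below x s → x ≠ a → f x + 1 ≤ R.c x) : a ∈ R.Vf v f s :=
  ⟨ha, a, ha, has, below.refl a, H, fun _ h1 h2 h3 => absurd (h2.antisymm h1) h3⟩

/-- The only terminal of `I(v)` in `V_f(t)` is `t`. -/
theorem IsBlocking.eq_of_mem {v s t : V} {f : V → ℕ} (h : R.IsBlocking v f) (ht : t ∈ R.Te v)
    (hs : s ∈ R.S v) (hst : s ∈ R.Vf v f t) : s = t := by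
  rcases hs with rfl | hs
  · exact absurd hst (h.2.2.1 t ht)
  · by_contra hne
    have := h.2.2.2.1 s hs t ht hne
    exact Set.eq_empty_iff_forall_notMem.1 this s
      ⟨mem_Vf_self (Set.mem_insert_of_mem _ hs.1), hst⟩

/-- In a decomposition of a blocking flow, a path that uses an edge of the cut of `V_f(t)`
ends in `t`. -/
theorem IsBlocking.mem_of_crosses_cut [Finite V] {v t x : V} {f : V → ℕ} {g : Sym2 V → ℕ}
    (hv : v ≠ R.root) (h : R.IsBlocking v f) (hg : R.IsDecomp v f g) (ht : t ∈ R.Te v)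
    {p : Sym2 V} (hp : g p ≠ 0) (hx : x ∈ R.cutE v (R.Vf v f t)) (hxp : R.Crosses x p) :
    t ∈ p := by
  have : Fintype (Sym2 V) := Fintype.ofFinite _
  have : Fintype V := Fintype.ofFinite _
  set C := (R.cutE v (R.Vf v f t)).toFinset with hC
  have hsum : f t = ∑ p, ∑ y ∈ C, if R.Crosses y p then g p else 0 := by
    rw [(h.2.2.2.2 t ht).1, hval, finsum_mem_eq_toFinset_sum, Finset.sum_comm]
    exact Finset.sum_congr rfl fun y hy => hg.apply_eq_sum (Set.mem_toFinset.1 hy).1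
  rw [hg.apply_eq_sum ht.1] at hsum
  have hle : ∀ p ∈ (Finset.univ : Finset (Sym2 V)), (if R.Crosses t p then g p else 0) ≤
      ∑ y ∈ C, if R.Crosses y p then g p else 0 := by
    intro p _
    induction p using Sym2.ind with | _ s s' =>
    by_cases hz : g s(s, s') = 0
    · simp [hz]
    obtain ⟨hs, hs', hne⟩ := hg.mem_S hz
    split_ifs with hc
    · have hcut : ∃ y ∈ R.cutE v (R.Vf v f t), R.onPath y s s' := by
        have htt := mem_Vf_self (f := f) (Set.mem_insert_of_mem (R.par v) ht.1)
        have hS := par_below_of_mem_S hv hs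
        have hS' := par_below_of_mem_S hv hs'
        rcases crosses_mk.1 hc with ⟨h1, -⟩ | ⟨-, h1⟩
        · obtain rfl := ht.2.eq_of_below h1
          exact exists_cut_onPath hS hS' htt
            (fun h' => hne (h.eq_of_mem ht hs' h').symm)
            fun x h1 h2 h3 => h3.elim (below_of_par_below hs h1 h2)
              (below_of_par_below hs' h1 h2)
        · obtain rfl := ht.2.eq_of_below h1
          obtain ⟨y, hy, hy'⟩ := exists_cut_onPath hS' hS htt
            (fun h' => hne (h.eq_of_mem ht hs h'))
            fun x h1 h2 h3 => h3.elim (below_of_par_below hs' h1 h2)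
              (below_of_par_below hs h1 h2)
          exact ⟨y, hy, by unfold onPath at *; tauto⟩
      obtain ⟨y, hy, hy'⟩ := hcut
      have := Finset.single_le_sum (f := fun y => if R.Crosses y s(s, s') then g s(s, s') else 0)
        (fun _ _ => Nat.zero_le _) (Set.mem_toFinset.2 hy : y ∈ C)
      simpa [crosses_mk.2 hy'] using this
    · exact Nat.zero_le _
  have heq : (if R.Crosses t p then g p else 0) =
      ∑ y ∈ C, if R.Crosses y p then g p else 0 :=
    (Finset.sum_eq_sum_iff_of_le hle).1 hsum p (Finset.mem_univ p)
  have hge : (if R.Crosses x p then g p else 0) ≤ ∑ y ∈ C, if R.Crosses y p then g p else 0 :=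
    Finset.single_le_sum (f := fun y => if R.Crosses y p then g p else 0)
      (fun _ _ => Nat.zero_le _) (Set.mem_toFinset.2 hx : x ∈ C)
  rw [if_pos hxp] at hge
  have hct : R.Crosses t p := by
    by_contra hct
    rw [if_neg hct] at heq
    omega
  obtain ⟨s, s', rfl, ⟨h1, -⟩ | ⟨-, h1⟩⟩ := hct
  · obtain rfl := ht.2.eq_of_below h1
    exact Sym2.mem_mk_left _ _
  · obtain rfl := ht.2.eq_of_below h1
    exact Sym2.mem_mk_right _ _

/-- In a decomposition of a blocking flow, a path that uses an edge with an endpoint in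
`V_f(t)` ends in `t`. -/
theorem IsBlocking.mem_of_crosses [Finite V] {v t x : V} {f : V → ℕ} {g : Sym2 V → ℕ}
    (hv : v ≠ R.root) (h : R.IsBlocking v f) (hg : R.IsDecomp v f g) (ht : t ∈ R.Te v)
    {p : Sym2 V} (hp : g p ≠ 0) (hvx : R.below v x)
    (hx : x ∈ R.Vf v f t ∨ R.par x ∈ R.Vf v f t) (hxp : R.Crosses x p) :
    t ∈ p := by
  by_contra htp
  have hcut : ∀ y, R.below v y → R.Crosses y p → (y ∈ R.Vf v f t ↔ R.par y ∈ R.Vf v f t) := by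
    intro y hy hyp
    by_contra hc
    exact htp (h.mem_of_crosses_cut hv hg ht hp ⟨hy, hc⟩ hyp)
  have hxX : x ∈ R.Vf v f t := hx.elim id (hcut x hvx hxp).2
  obtain ⟨s, s', rfl, hss⟩ := hxp
  obtain ⟨hs, hs', hne⟩ := hg.mem_S hp
  rcases hss with ⟨h1, h2⟩ | ⟨h2, h1⟩
  · have := (mem_iff_of_not_cut h1 fun y hxy hys _ => hcut y (hvx.trans hxy)
      (crosses_mk.2 (Or.inl ⟨hys, fun h => h2 (hxy.trans h)⟩))).1 hxX
    obtain rfl := h.eq_of_mem ht hs this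
    exact htp (Sym2.mem_mk_left _ _)
  · have := (mem_iff_of_not_cut h1 fun y hxy hys _ => hcut y (hvx.trans hxy)
      (crosses_mk.2 (Or.inr ⟨fun h => h2 (hxy.trans h), hys⟩))).1 hxX
    obtain rfl := h.eq_of_mem ht hs' this
    exact htp (Sym2.mem_mk_right _ _)

/-- At a vertex of `V_f(t)` above `t`, all flow comes up from `t`. -/
theorem IsBlocking.eq_add_of_below [Finite V] {v t a b q : V} {f : V → ℕ}
    (hv : v ≠ R.root) (h : R.IsBlocking v f) (ht : t ∈ R.Te v) (hva : R.below v a)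
    (ha : a ∈ R.Vf v f t) (hbq : b ≠ q) (hch : R.children a = {b, q}) (hbt : R.below b t) :
    f b = f a + f q := by
  obtain ⟨g, hg⟩ := h.1
  have hb : b ∈ R.children a := hch ▸ Or.inl rfl
  have hq : q ∈ R.children a := hch ▸ Or.inr rfl
  have hvb := hva.trans (below_child hb)
  have hvq := hva.trans (below_child hq)
  have hat := (below_child hb).trans hbt
  have hqt := not_below_of_sibling hb hq hbq hbt
  refine hg.eq_add hvb hva hvq fun p hp => ?_
  by_cases htp : t ∈ p
  · obtain ⟨s, rfl⟩ := htp
    obtain ⟨-, hs, -⟩ := hg.mem_S hp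
    have h1 := below_iff_of_children hv hva hch hs
    have h2 := fun h => not_below_of_sibling hb hq hbq (s := s) h
    simp only [crosses_mk, onPath]
    tauto
  · have h1 := fun hx => htp (h.mem_of_crosses hv hg ht hp hva (Or.inl ha) hx)
    have h2 := fun hx => htp (h.mem_of_crosses hv hg ht hp hvb (Or.inr (hb.1.symm ▸ ha)) hx)
    have h3 := fun hx => htp (h.mem_of_crosses hv hg ht hp hvq (Or.inr (hq.1.symm ▸ ha)) hx)
    tauto

/-- At a vertex of `V_f(t)` not above `t`, all flow comes down from `t`. -/
theorem IsBlocking.eq_add_of_not_below [Finite V] {v t a b q : V} {f : V → ℕ}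
    (hv : v ≠ R.root) (h : R.IsBlocking v f) (ht : t ∈ R.Te v) (hva : R.below v a)
    (ha : a ∈ R.Vf v f t) (hbq : b ≠ q) (hch : R.children a = {b, q}) (hat : ¬ R.below a t) :
    f a = f b + f q := by
  obtain ⟨g, hg⟩ := h.1
  have hb : b ∈ R.children a := hch ▸ Or.inl rfl
  have hq : q ∈ R.children a := hch ▸ Or.inr rfl
  have hvb := hva.trans (below_child hb)
  have hvq := hva.trans (below_child hq)
  have hbt := fun h => hat ((below_child hb).trans h)
  have hqt := fun h => hat ((below_child hq).trans h)
  refine hg.eq_add hva hvb hvq fun p hp => ?_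
  by_cases htp : t ∈ p
  · obtain ⟨s, rfl⟩ := htp
    obtain ⟨-, hs, -⟩ := hg.mem_S hp
    have h1 := below_iff_of_children hv hva hch hs
    have h2 := fun h => not_below_of_sibling hb hq hbq (s := s) h
    simp only [crosses_mk, onPath]
    tauto
  · have h1 := fun hx => htp (h.mem_of_crosses hv hg ht hp hva (Or.inl ha) hx)
    have h2 := fun hx => htp (h.mem_of_crosses hv hg ht hp hvb (Or.inr (hb.1.symm ▸ ha)) hx)
    have h3 := fun hx => htp (h.mem_of_crosses hv hg ht hp hvq (Or.inr (hq.1.symm ▸ ha)) hx)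
    tauto

theorem Ve_mono {v y : V} (hvy : R.below v y) (hne : v ≠ y) : R.Ve y ⊆ R.Ve v := by
  rintro w (rfl | hw)
  · rcases hvy.eq_or with h | h
    · exact absurd h hne
    · exact Or.inr h.2
  · exact Or.inr (hvy.trans hw)

theorem not_below_par_of_below {v y w : V} (hv : v ≠ R.root) (hvy : R.below v y)
    (hyw : R.below y w) : ¬ R.below w (R.par v) :=
  fun h => not_below_par hv (hvy.trans (hyw.trans h))

/-- Flows restrict to subtrees. -/
theorem IsFlow.restrict [Finite V] {v y : V} {f : V → ℕ} (hv : v ≠ R.root)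
    (h : R.IsFlow v f) (hvy : R.below v y) : R.IsFlow y f := by
  have : Fintype (Sym2 V) := Fintype.ofFinite _
  obtain ⟨g, hg⟩ := h
  have hy := hvy.ne_root hv
  let φ : V → V := fun s => if R.below y s then s else R.par y
  have hφ : ∀ w s, R.below y w → (R.below w (φ s) ↔ R.below w s) := by
    intro w s hyw
    simp only [φ]
    split_ifs with hs
    · rfl
    · exact ⟨fun h => absurd h (not_below_par_of_below hy (below.refl y) hyw),
        fun h => absurd (hyw.trans h) hs⟩
  have hφS : ∀ s ∈ R.S v, φ s ∈ R.S y := by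
    intro s hs
    simp only [φ]
    split_ifs with hys
    · rcases hs with rfl | hs
      · exact absurd hys (not_below_par_of_below hv hvy (below.refl y))
      · exact Or.inr ⟨hys, hs.2⟩
    · exact Or.inl rfl
  refine ⟨fun p => ∑ p', if Sym2.map φ p' = p ∧ ¬ p.IsDiag then g p' else 0, ?_, ?_⟩
  · intro p hp
    obtain ⟨p', -, hp'⟩ := Finset.exists_ne_zero_of_sum_ne_zero hp
    rw [ne_eq, ite_eq_right_iff, Classical.not_imp] at hp'
    obtain ⟨⟨h1, h2⟩, h3⟩ := hp'
    induction p' using Sym2.ind with | _ s s' =>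
    obtain ⟨hs, hs', -⟩ := hg.mem_S h3
    rw [Sym2.map_mk] at h1
    refine ⟨φ s, φ s', hφS s hs, hφS s' hs', ?_, h1.symm⟩
    rintro heq
    rw [← h1, heq] at h2
    exact h2 (Sym2.mk_isDiag_iff.2 rfl)
  · intro w hw
    rw [hg.apply_eq_sum (hvy.trans hw), finsum_mem_def, finsum_eq_sum_of_fintype]
    have hcr : ∀ p', R.Crosses w (Sym2.map φ p') ↔ R.Crosses w p' := by
      intro p'
      induction p' using Sym2.ind with | _ s s' =>
      rw [Sym2.map_mk, crosses_mk, crosses_mk, onPath, onPath, hφ w s hw, hφ w s' hw]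
    have hdiag : ∀ p, R.Crosses w p → ¬ p.IsDiag := by
      rintro _ ⟨s, s', rfl, hss⟩ hd
      rw [Sym2.mk_isDiag_iff] at hd
      subst hd
      unfold onPath at hss
      tauto
    have hind : ∀ p, Set.indicator {p : Sym2 V | ∃ t t', p = s(t, t') ∧ R.onPath w t t'}
        (fun p => ∑ p', if Sym2.map φ p' = p ∧ ¬ p.IsDiag then g p' else 0) p =
        ∑ p', if Sym2.map φ p' = p then (if R.Crosses w p' then g p' else 0) else 0 := by
      intro p
      by_cases hp : R.Crosses w p
      · rw [Set.indicator_of_mem (by exact hp)]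
        refine Finset.sum_congr rfl fun p' _ => ?_
        by_cases h1 : Sym2.map φ p' = p
        · have : R.Crosses w p' := (hcr p').1 (h1 ▸ hp)
          simp [h1, this, hdiag p hp]
        · simp [h1]
      · rw [Set.indicator_of_notMem (by exact hp)]
        refine (Finset.sum_eq_zero fun p' _ => ?_).symm
        by_cases h1 : Sym2.map φ p' = p
        · have : ¬ R.Crosses w p' := fun h => hp (h1 ▸ (hcr p').2 h)
          simp [this]
        · simp [h1]
    rw [Finset.sum_congr rfl fun p _ => hind p, Finset.sum_comm]
    refine Finset.sum_congr rfl fun p' _ => ?_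
    rw [Finset.sum_ite_eq]
    simp

theorem cutE_eq_of_subset {v y : V} {X : Set V} (hv : v ≠ R.root) (hvy : R.below v y)
    (hX : ∀ x ∈ X, R.below y x) : R.cutE y X = R.cutE v X := by
  ext x
  refine ⟨fun h => ⟨hvy.trans h.1, h.2⟩, fun h => ⟨?_, h.2⟩⟩
  by_cases hx : x ∈ X
  · exact hX x hx
  · have hpx : R.par x ∈ X := by
      by_contra hpx
      exact h.2 ⟨fun h => absurd h hx, fun h => absurd h hpx⟩
    exact (hX _ hpx).trans (below_par (h.1.ne_root hv))

theorem hval_eq_of_subset {v y : V} {X : Set V} (hv : v ≠ R.root) (hvy : R.below v y)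
    (hX : ∀ x ∈ X, R.below y x) (h : V → ℕ) : R.hval y X h = R.hval v X h := by
  rw [hval, hval, cutE_eq_of_subset hv hvy hX]

theorem Vf_restrict {v y s : V} {f : V → ℕ} (hvy : R.below v y)
    (hne : v ≠ y) (hs : s ∈ R.Te y) (hp : R.par y ∉ R.Vf v f s) :
    R.Vf y f s = R.Vf v f s ∧ ∀ x ∈ R.Vf v f s, R.below y x := by
  have key : ∀ z, R.below z s →
      (∀ x, R.below z x → R.below x s → x ≠ z → f x + 1 ≤ R.c x) → R.below y z := by
    intro z hzs hup
    rcases hs.1.total hzs with h | h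
    · exact h
    · rcases h.eq_or with rfl | ⟨hy, h⟩
      · exact below.refl _
      · refine absurd (mem_Vf_of_up (Ve_mono hvy hne (Or.inl rfl))
          ((below_par hy).trans hs.1) fun x h1 h2 h3 => hup x (h.trans h1) h2 ?_) hp
        rintro rfl
        exact h3 (h.antisymm h1)
  refine ⟨Set.Subset.antisymm ?_ ?_, ?_⟩
  · rintro w ⟨hw, z, hz, h⟩
    exact ⟨Ve_mono hvy hne hw, z, Ve_mono hvy hne hz, h⟩
  · rintro w ⟨hw, z, hz, h1, h2, h3, h4⟩
    have hyz := key z h1 h3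
    exact ⟨Or.inr (hyz.trans h2), z, Or.inr hyz, h1, h2, h3, h4⟩
  · rintro w ⟨hw, z, hz, h1, h2, h3, h4⟩
    exact (key z h1 h3).trans h2

/-- A connected set containing `y` but not its parent lies below `y`. -/
theorem ConnSet.below_of_par_notMem {W : Set V} {y w : V} (hW : R.ConnSet W) (hy : y ∈ W)
    (hpy : R.par y ∉ W) (hw : w ∈ W) : R.below y w := by
  by_contra hc
  have hyr : y ≠ R.root := by
    rintro rfl
    rw [R.par_root] at hpy
    exact hpy hy
  refine hpy (hW y hy w hw _ ⟨Or.inl (below_par hyr), fun z h1 h2 => ?_⟩)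
  rcases h1.eq_or with rfl | h
  · exact absurd h2 hc
  · exact h.2

/-- A blocking flow restricts to a blocking flow on the subtree of `y`, provided that `par y`
cannot be reached from the terminals below `y`. -/
theorem IsBlocking.restrict [Finite V] {v y : V} {f : V → ℕ} (hv : v ≠ R.root)
    (h : R.IsBlocking v f) (hvy : R.below v y) (hne : v ≠ y)
    (hp : ∀ s ∈ R.Te y, R.par y ∉ R.Vf v f s) : R.IsBlocking y f := by
  have hVf := fun s hs => Vf_restrict (f := f) hvy hne hs (hp s hs)
  obtain ⟨h1, h2, h3, h4, h5⟩ := h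
  refine ⟨h1.restrict hv hvy, fun w hw => h2 w (hvy.trans hw), fun s hs => ?_,
    fun s hs s' hs' hss => ?_, fun s hs => ?_⟩
  · rw [(hVf s hs).1]
    exact hp s hs
  · rw [(hVf s hs).1, (hVf s' hs').1]
    exact h4 s (mem_Te_mono hvy hs) s' (mem_Te_mono hvy hs') hss
  · have hsub := (hVf s hs).2
    rw [(hVf s hs).1, hval_eq_of_subset hv hvy hsub, hval_eq_of_subset hv hvy hsub]
    have hA : ∀ y₀, y₀ ≠ R.root → R.par y₀ ∈ R.Vf v f s → ∀ w, R.below y₀ w →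
        (w ∈ R.Ve y \ R.UT y f ↔ w ∈ R.Ve v \ R.UT v f) := by
      intro y₀ hy₀ hpy w hw
      have hyp := hsub _ hpy
      have hpw := (below_par hy₀).trans hw
      have hyw := hyp.trans hpw
      have hU : w ∈ R.UT y f ↔ w ∈ R.UT v f := by
        simp only [UT, Set.mem_iUnion]
        constructor
        · rintro ⟨s', hs', hw'⟩
          exact ⟨s', mem_Te_mono hvy hs', (hVf s' hs').1 ▸ hw'⟩
        · rintro ⟨s', hs', hw'⟩
          by_cases hys : R.below y s'
          · exact ⟨s', ⟨hys, hs'.2⟩, (hVf s' ⟨hys, hs'.2⟩).1.symm ▸ hw'⟩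
          · exfalso
            obtain ⟨-, z, hz, k1, k2, k3, k4⟩ := hw'
            have hzp : R.below z (R.par y₀) := by
              rcases k2.total hyw with h | h
              · exact h.trans hyp
              · exact absurd (h.trans k1) hys
            have hmem : R.par y₀ ∈ R.Vf v f s' :=
              ⟨Or.inr (hvy.trans hyp), z, hz, k1, hzp, k3,
                fun x e1 e2 e3 => k4 x e1 (e2.trans hpw) e3⟩
            have hss : s ≠ s' := by
              rintro rfl
              exact hys hs.1
            exact Set.eq_empty_iff_forall_notMem.1 (h4 s (mem_Te_mono hvy hs) s' hs' hss) _
              ⟨hpy, hmem⟩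
      rw [Set.mem_sdiff, Set.mem_sdiff, hU]
      exact and_congr_left fun _ => ⟨fun _ => Or.inr (hvy.trans hyw), fun _ => Or.inr hyw⟩
    have hodd : R.oddOf y (R.UT y f) (R.Vf v f s) = R.oddOf v (R.UT v f) (R.Vf v f s) := by
      ext W
      simp only [oddOf, IsComp, Set.mem_ofPred_eq]
      have hpA : ∀ x, x ∈ R.Vf v f s → x ∉ R.Ve y \ R.UT y f ∧ x ∉ R.Ve v \ R.UT v f := by
        intro x hx
        refine ⟨fun h => h.2 ?_, fun h => h.2 ?_⟩
        · exact Set.mem_biUnion hs ((hVf s hs).1.symm ▸ hx)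
        · exact Set.mem_biUnion (mem_Te_mono hvy hs) hx
      constructor
      · rintro ⟨⟨e1, e2, e3, e4, e5⟩, e6, y₀, e7, e8, e9⟩
        have hbel := fun w hw => e3.below_of_par_notMem e7 e8 (w := w) hw
        have hy₀ : y₀ ≠ R.root := by
          rintro rfl
          rw [R.par_root] at e8
          exact e8 e7
        have hA' := hA y₀ hy₀ e9
        have hyy₀ := (hsub _ e9).trans (below_par hy₀)
        have hWy := fun w hw => hyy₀.trans (hbel w hw)
        refine ⟨⟨e1, fun w hw => (hA' w (hbel w hw)).1 (e2 hw), e3, fun x _ hx hpx => ?_,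
          fun x hvx hx hxA => ?_⟩, ?_, y₀, e7, e8, e9⟩
        · rcases (hbel x hx).eq_or with rfl | ⟨_, h⟩
          · exact absurd hpx (hpA _ e9).2
          · exact e4 x (hWy x hx) hx ((hA' _ h).2 hpx)
        · have hxy := (hbel _ hx).trans (below_par (hvx.ne_root hv))
          exact e5 x (hyy₀.trans hxy) hx ((hA' _ hxy).2 hxA)
        · rwa [← hval_eq_of_subset hv hvy hWy]
      · rintro ⟨⟨e1, e2, e3, e4, e5⟩, e6, y₀, e7, e8, e9⟩
        have hbel := fun w hw => e3.below_of_par_notMem e7 e8 (w := w) hw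
        have hy₀ : y₀ ≠ R.root := by
          rintro rfl
          rw [R.par_root] at e8
          exact e8 e7
        have hA' := hA y₀ hy₀ e9
        have hyy₀ := (hsub _ e9).trans (below_par hy₀)
        have hWy := fun w hw => hyy₀.trans (hbel w hw)
        refine ⟨⟨e1, fun w hw => (hA' w (hbel w hw)).2 (e2 hw), e3, fun x hyx hx hpx => ?_,
          fun x hyx hx hxA => ?_⟩, ?_, y₀, e7, e8, e9⟩
        · rcases (hbel x hx).eq_or with rfl | ⟨_, h⟩
          · exact absurd hpx (hpA _ e9).1
          · exact e4 x (hvy.trans hyx) hx ((hA' _ h).1 hpx)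
        · have hxy := (hbel _ hx).trans (below_par ((hvy.trans hyx).ne_root hv))
          exact e5 x (hvy.trans hyx) hx ((hA' _ hxy).1 hxA)
        · rwa [hval_eq_of_subset hv hvy hWy]
    rw [hodd]
    exact h5 s (mem_Te_mono hvy hs)

theorem CondA.cap_mem {y : V} (hy : y ≠ R.root) (h : R.CondA y) : R.c y ∈ R.Psi y := by
  by_cases hl : R.leaf y
  · rw [h.2.1 hl]
    rfl
  · obtain ⟨b, hb⟩ := exists_child_of_not_leaf hy hl
    obtain ⟨q, hbq, hch⟩ := exists_sibling hy hb
    rw [h.2.2 b q hbq hch]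
    exact Or.inr rfl

theorem le_cap_of_mem_Psi {y : V} {k : ℕ} (h : k ∈ R.Psi y) : k ≤ R.c y := by
  obtain ⟨f, hf, rfl⟩ := h
  exact hf.2.1 y (below.refl y)

theorem CondA.cap_le_add [Finite V] {y b q : V} (hy : y ≠ R.root) (h : R.CondA y)
    (hch : R.children y = {b, q}) : R.c y ≤ R.c b + R.c q := by
  have hb : b ∈ R.children y := hch ▸ Or.inl rfl
  have hq : q ∈ R.children y := hch ▸ Or.inr rfl
  obtain ⟨f, hf, hfy⟩ := h.cap_mem hy
  obtain ⟨g, hg⟩ := hf.1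
  have := hg.parent_le hy (below.refl y) hch
  have := hf.2.1 b (below_child hb)
  have := hf.2.1 q (below_child hq)
  omega

theorem bE_le_cap {y : V} (hy : (R.Psi y).Nonempty) : R.bE y ≤ R.c y :=
  csSup_le hy fun _ h => le_cap_of_mem_Psi h

theorem IsBlocking.eq_cap_of_par_notMem [Finite V] {v y t : V} {f : V → ℕ}
    (hv : v ≠ R.root) (h : R.IsBlocking v f) (ht : t ∈ R.Te v) (hvy : R.below v y)
    (hne : v ≠ y) (hA : R.CondA y) (hp : R.par y ∈ R.Vf v f t) (hyt : ¬ R.below y t)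
    (hy : y ∉ R.Vf v f t) : f y = R.c y := by
  have hcap := hA.cap_mem (hvy.ne_root hv)
  have hmem : f y ∈ R.Psi y := by
    refine ⟨f, h.restrict hv hvy hne fun s hs hps => ?_, rfl⟩
    have hst : s ≠ t := by
      rintro rfl
      exact hyt hs.1
    exact Set.eq_empty_iff_forall_notMem.1
      (h.2.2.2.1 s (mem_Te_mono hvy hs) t ht hst) _ ⟨hps, hp⟩
  have hge : R.c y ≤ f y + 1 := by
    by_contra hlt
    obtain ⟨-, z, hz, h1, h2, h3, h4⟩ := hp
    refine hy ⟨Or.inr hvy, z, hz, h1, h2.trans (below_par (hvy.ne_root hv)), h3,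
      fun x hzx hxy hxz => ?_⟩
    rcases hxy.eq_or with rfl | ⟨_, hxy⟩
    · omega
    · exact h4 x hzx hxy hxz
  have hle := le_cap_of_mem_Psi hmem
  obtain ⟨a, b, hab⟩ := hA.1
  rw [hab] at hmem hcap
  have := hmem.2.2
  have := hcap.2.2
  omega

/-- Every edge hanging off `V_f(t)`, or lying in `V_f(t)` but not above `t`, is saturated. -/
theorem IsBlocking.eq_cap [Finite V] {v t : V} {f : V → ℕ} (hv : v ≠ R.root)
    (hind : ∀ x, x ≠ R.root → R.dep v < R.dep x → R.CondA x)
    (h : R.IsBlocking v f) (ht : t ∈ R.Te v) (y : V) (hvy : R.below v y) (hne : v ≠ y)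
    (hp : R.par y ∈ R.Vf v f t) (hyt : ¬ R.below y t) : f y = R.c y := by
  obtain ⟨N, hN⟩ := (Set.finite_range R.dep).bddAbove
  have hN : ∀ x, R.dep x ≤ N := fun x => hN ⟨x, rfl⟩
  induction hn : N - R.dep y using Nat.strong_induction_on generalizing y with
  | _ n ih =>
  have hyr := hvy.ne_root hv
  have hA : R.CondA y := hind y hyr <| lt_of_not_ge fun hd => hne (hvy.eq_of_dep_le hd)
  by_cases hy : y ∈ R.Vf v f t
  · have hl : ¬ R.leaf y := by
      intro hl
      obtain rfl := h.eq_of_mem ht (Or.inr ⟨hvy, hl⟩) hy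
      exact hyt (below.refl _)
    obtain ⟨b, hb⟩ := exists_child_of_not_leaf hyr hl
    obtain ⟨q, hbq, hch⟩ := exists_sibling hyr hb
    have hsat : ∀ x ∈ R.children y, f x = R.c x := by
      intro x hx
      have hd := R.dep_par x hx.2
      rw [hx.1] at hd
      have := hN x
      refine ih (N - R.dep x) (by omega) x (hvy.trans (below_child hx)) ?_ (hx.1.symm ▸ hy)
        (fun h => hyt ((below_child hx).trans h)) rfl
      rintro rfl
      exact not_below_par hx.2 (hx.1.symm ▸ hvy)
    have h1 := hsat b hb
    have h2 := hsat q (hch ▸ Or.inr rfl)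
    have h3 := h.eq_add_of_not_below hv ht hvy hy hbq hch hyt
    have h4 := hA.cap_le_add hyr hch
    have h5 := h.2.1 y hvy
    omega
  · exact h.eq_cap_of_par_notMem hv ht hvy hne hA hp hyt hy

/-- If `v ∈ V_f(t)` then every edge strictly between `v` and `t` has a free unit, and
`(par v, v)` is saturated. -/
theorem IsBlocking.add_one_le_cap {v t : V} {f : V → ℕ} (h : R.IsBlocking v f)
    (ht : t ∈ R.Te v) (hvX : v ∈ R.Vf v f t) {x : V} (hvx : R.below v x) (hxt : R.below x t)
    (hne : x ≠ v) : f x + 1 ≤ R.c x := by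
  obtain ⟨-, z, hz, h1, h2, h3, -⟩ := hvX
  rcases hz with rfl | hz
  · exact absurd (mem_Vf_of_up (Or.inl rfl) h1 h3) (h.2.2.1 t ht)
  · obtain rfl := h2.antisymm hz
    exact h3 x hvx hxt hne

theorem IsBlocking.eq_cap_of_free {v t : V} {f : V → ℕ} (hv : v ≠ R.root)
    (h : R.IsBlocking v f) (ht : t ∈ R.Te v)
    (H : ∀ x, R.below v x → R.below x t → x ≠ v → f x + 1 ≤ R.c x) : f v = R.c v := by
  by_contra hc
  have hle := h.2.1 v (below.refl v)
  refine h.2.2.1 t ht (mem_Vf_of_up (Or.inl rfl) ((below_par hv).trans ht.1)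
    fun x h1 h2 h3 => ?_)
  have hvx := below_of_par_below (Or.inr ht) h1 h3 h2
  by_cases hxv : x = v
  · subst hxv
    omega
  · exact H x hvx h2 hxv

/-- If all edges strictly between `v` and `t` have a free unit, then the flow on `(par v, v)`
saturates it and comes entirely from `t`. -/
theorem IsBlocking.cap_le_of_free [Finite V] {v t : V} {f : V → ℕ} {g : Sym2 V → ℕ}
    (hv : v ≠ R.root) (h : R.IsBlocking v f) (hg : R.IsDecomp v f g) (ht : t ∈ R.Te v)
    (H : ∀ x, R.below v x → R.below x t → x ≠ v → f x + 1 ≤ R.c x) :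
    R.c v ≤ g s(R.par v, t) := by
  have : Fintype (Sym2 V) := Fintype.ofFinite _
  rw [← h.eq_cap_of_free hv ht H, hg.apply_eq_sum (below.refl v)]
  have hvX : v ∈ R.Vf v f t := mem_Vf_of_up (Or.inr (below.refl v)) ht.1 H
  refine (Finset.sum_eq_single_of_mem s(R.par v, t) (Finset.mem_univ _)
    fun p _ hp => ?_).le.trans ?_
  · rw [ite_eq_right_iff]
    intro hvp
    by_contra hgp
    obtain ⟨s, rfl⟩ := h.mem_of_crosses hv hg ht hgp (below.refl v) (Or.inl hvX) hvp
    obtain ⟨-, hs, -⟩ := hg.mem_S hgp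
    rcases hs with rfl | hs
    · exact hp Sym2.eq_swap
    · rcases crosses_mk.1 hvp with h' | h'
      · exact h'.2 hs.1
      · exact h'.1 ht.1
  · split_ifs
    · exact le_rfl
    · exact Nat.zero_le _

/-- All elements of `A ⊗ B` exceed `k` once `A` lies strictly above `k + m` and `B` is bounded
by `m`. -/
theorem lt_of_mem_otimes {A B : Set ℕ} {k m n : ℕ} (hA : ∀ a ∈ A, k + m < a)
    (hB : ∀ b ∈ B, b ≤ m) (hn : n ∈ otimes A B) : k < n := by
  obtain ⟨a, ha, b, hb, i, hi, rfl⟩ := hn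
  have := hA a ha
  have := hB b hb
  have := le_min_iff.1 hi
  omega

theorem otimes_comm (A B : Set ℕ) : otimes A B = otimes B A := by
  ext x
  constructor
  · rintro ⟨a, ha, b, hb, i, hi, rfl⟩
    exact ⟨b, hb, a, ha, i, min_comm a b ▸ hi, by rw [add_comm]⟩
  · rintro ⟨a, ha, b, hb, i, hi, rfl⟩
    exact ⟨b, hb, a, ha, i, min_comm a b ▸ hi, by rw [add_comm]⟩

end RTI

/-- Main Lemma (i): let `e = (u,v)` be a non-leaf-edge, assume all
strictly deeper edges satisfy conditions (a) and (b), and let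
`⟨ã,b̃⟩ = Ψ(e₁) ⊗ Ψ(e₂)` for the two child-edges `e₁, e₂` of `e`.  If `f` is a
blocking flow of `I(e)` with `e ∈ E(V_f(t))` for some terminal `t ∈ T_e`, then the
path `P_{v,t}` is a dominating path, every decomposition `g` of every blocking flow
of `I(e)` satisfies `g(u,t) ≥ c(e)`, and `c(e) < ã`. -/
theorem RTI.mainLemma_i {V : Type*} [Fintype V] [DecidableEq V]
    (R : RTI V) (v : V) (hv : v ≠ R.root)
    (w₁ w₂ : V) (hw : w₁ ≠ w₂) (hch : R.children v = {w₁, w₂})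
    (hind : ∀ x, x ≠ R.root → R.dep v < R.dep x → R.CondA x ∧ R.CondB x)
    (ta tb : ℕ) (hab : otimes (R.Psi w₁) (R.Psi w₂) = Iv ta tb)
    (f : V → ℕ) (hf : R.IsBlocking v f)
    (t : V) (ht : t ∈ R.Te v) (hvt : v ∈ R.cutE v (R.Vf v f t)) :
    R.DomPath v t ∧
    (∀ f' g', R.IsBlocking v f' → R.IsDecomp v f' g' → R.c v ≤ g' s(R.par v, t)) ∧
    R.c v < ta := by
  have hA : ∀ x, x ≠ R.root → R.dep v < R.dep x → R.CondA x := fun x h1 h2 => (hind x h1 h2).1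
  have hA' : ∀ x, R.below v x → v ≠ x → R.CondA x := fun x h1 h2 =>
    hA x (h1.ne_root hv) (lt_of_not_ge fun hd => h2 (h1.eq_of_dep_le hd))
  have hvX : v ∈ R.Vf v f t := by
    by_contra hc
    exact hvt.2 ⟨fun h => absurd h hc, fun h => absurd h (hf.2.2.1 t ht)⟩
  have hfree : ∀ x, R.below v x → R.below x t → x ≠ v → f x + 1 ≤ R.c x :=
    fun x => hf.add_one_le_cap ht hvX
  have hfv := hf.eq_cap_of_free hv ht hfree
  have hmem : ∀ a, R.below v a → R.below a t → a ∈ R.Vf v f t := fun a h1 h2 =>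
    RTI.mem_Vf_of_up (Or.inr h1) h2 fun x h3 h4 h5 => hfree x (h1.trans h3) h4 <| by
      rintro rfl
      exact h5 (h1.antisymm h3)
  have hstar : ∀ a b, R.below v a → b ∈ R.children a → R.below b t →
      ∃ q, b ≠ q ∧ R.children a = {b, q} ∧ f b = f a + f q ∧ f q = R.c q := by
    intro a b hva hb hbt
    have hat := (RTI.below_child hb).trans hbt
    obtain ⟨q, hbq, hch'⟩ := RTI.exists_sibling (hva.ne_root hv) hb
    have hq : q ∈ R.children a := hch' ▸ Or.inr rfl
    refine ⟨q, hbq, hch', hf.eq_add_of_below hv ht hva (hmem a hva hat) hbq hch' hbt,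
      hf.eq_cap hv hA ht q (hva.trans (RTI.below_child hq)) ?_ (hq.1.symm ▸ hmem a hva hat)
        (RTI.not_below_of_sibling hb hq hbq hbt)⟩
    rintro rfl
    exact RTI.not_below_par hq.2 (hq.1.symm ▸ hva)
  have hpos : ∀ a, R.below v a → R.below a t → 1 ≤ f a := by
    intro a hva
    induction hva with
    | refl => exact fun _ => hfv ▸ R.cap_pos v hv
    | tail h1 h2 ih =>
      intro hct
      obtain ⟨q, -, -, h3, -⟩ := hstar _ _ h1 h2 hct
      have := ih ((RTI.below_child h2).trans hct)
      omega
  have hnv : ∀ {a b}, R.below v a → b ∈ R.children a → v ≠ b := by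
    rintro a b hva hb rfl
    exact RTI.not_below_par hb.2 (hb.1.symm ▸ hva)
  have hlow : ∀ a, R.below a t → R.below v a → v ≠ a → ∀ m ∈ R.Psi a, f a < m := by
    intro a hat
    induction hat using Relation.ReflTransGen.head_induction_on with
    | refl =>
      intro hvt' hne m hm
      rw [(hA' t hvt' hne).2.1 ht.2] at hm
      obtain rfl := hm
      exact hfree t hvt' (RTI.below.refl t) hne.symm
    | head h1 h2 ih =>
      rename_i a b
      intro hva hne m hm
      obtain ⟨q, hbq, hch', h3, h4⟩ := hstar a b hva h1 h2
      rw [(hA' a hva hne).2.2 b q hbq hch'] at hm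
      rcases hm with hm | hm
      · refine RTI.lt_of_mem_otimes (m := f q) (fun x hx => ?_) (fun x hx => ?_) hm.1
        · exact h3 ▸ ih (hva.trans (RTI.below_child h1)) (hnv hva h1) x hx
        · exact h4 ▸ RTI.le_cap_of_mem_Psi hx
      · obtain rfl := hm
        exact hfree a hva ((RTI.below_child h1).trans h2) hne.symm
  have hcap : ∀ a, R.below v a → v ≠ a → R.c a ∈ R.Psi a := fun a h1 h2 =>
    (hA' a h1 h2).cap_mem (h1.ne_root hv)
  refine ⟨⟨ht.1, fun x hvx hxt hne => ?_⟩, fun f' g' hf' hg' => ?_, ?_⟩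
  · have hxr := hvx.ne_root hv
    have hva : R.below v (R.par x) := by
      rcases hvx.eq_or with h | h
      · exact absurd h.symm hne
      · exact h.2
    have hx : x ∈ R.children (R.par x) := ⟨rfl, hxr⟩
    obtain ⟨q, hxq, hch', h3, h4⟩ := hstar _ x hva hx hxt
    have hq : q ∈ R.children (R.par x) := hch' ▸ Or.inr rfl
    refine ⟨hxr, q, hq.2, hxq.symm, hq.1, ?_⟩
    have h5 : R.bE q ≤ R.c q := RTI.bE_le_cap
      ⟨_, hcap q (hva.trans (RTI.below_child hq)) (hnv hva hq)⟩
    have h6 : f x < R.aE x := hlow x hxt hvx hne.symm _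
      (Nat.sInf_mem ⟨_, hcap x hvx hne.symm⟩)
    have h7 := hpos _ hva ((RTI.below_child hx).trans hxt)
    omega
  · have hle : ∀ a, R.below v a → R.below a t → f' a ≤ f a := by
      intro a hva
      induction hva with
      | refl => exact fun _ => hfv ▸ hf'.2.1 v (RTI.below.refl v)
      | tail h1 h2 ih =>
        intro hct
        obtain ⟨q, hbq, hch', h3, h4⟩ := hstar _ _ h1 h2 hct
        have h5 := ih ((RTI.below_child h2).trans hct)
        have h6 := hg'.child_le hv h1 hbq hch'
        have h7 := hf'.2.1 q (h1.trans (RTI.below_child (hch'.symm ▸ Or.inr rfl)))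
        omega
    exact hf'.cap_le_of_free hv hg' ht fun x h1 h2 h3 =>
      (Nat.add_le_add_right (hle x h1 h2) 1).trans (hfree x h1 h2 h3)
  · have hvt' : v ≠ t := by
      rintro rfl
      have hw₁ : w₁ ∈ R.children v := hch ▸ Or.inl rfl
      exact ht.2.2 w₁ hw₁.2 hw₁.1
    obtain ⟨b, hb, hbt⟩ := ht.1.exists_child hvt'
    have hvv := RTI.below.refl (R := R) v
    obtain ⟨q, hbq, hch', h3, h4⟩ := hstar v b hvv hb hbt
    have hq : q ∈ R.children v := hch' ▸ Or.inr rfl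
    have hlt : ∀ m ∈ otimes (R.Psi b) (R.Psi q), R.c v < m := fun m hm =>
      RTI.lt_of_mem_otimes (m := f q)
        (fun x hx => hfv ▸ h3 ▸ hlow b hbt (RTI.below_child hb) (hnv hvv hb) x hx)
        (fun x hx => h4 ▸ RTI.le_cap_of_mem_Psi hx) hm
    have heq : otimes (R.Psi w₁) (R.Psi w₂) = otimes (R.Psi b) (R.Psi q) := by
      rw [hch] at hb hq
      rcases hb with rfl | rfl <;> rcases hq with rfl | rfl
      · exact absurd rfl hbq
      · rfl
      · exact RTI.otimes_comm _ _
      · exact absurd rfl hbq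
    rw [← heq, hab] at hlt
    have hne : R.c b + R.c q ∈ Iv ta tb := by
      rw [← hab, heq]
      exact ⟨_, hcap b (RTI.below_child hb) (hnv hvv hb), _,
        hcap q (RTI.below_child hq) (hnv hvv hq), 0, Nat.zero_le _, by simp⟩
    exact hlt ta ⟨le_rfl, hne.1.trans hne.2.1, rfl⟩
end
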